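/- arXiv:1402.4644 — 11 statements merged into one kernel-verified Lean document; each statement's English description precedes it below -/
import Mathlib

section
/- Let (Q,·) and (K,+) be quasigroups with K nonempty. Let φ : K → K and τ : K → K be bijections, each satisfying φ(φ(α)) = α, φ(α+β) = φ(α)+φ(β), τ(τ(α)) = α and τ(α+β) = τ(α)+τ(β) for all α, β ∈ K (i.e., φ and τ are involutory automorphisms of (K,+)). Define a second operation ∗ on K by α∗β = φ(α)+φ(β) (the principal isotope of (K,+) determined by φ₁ = φ₂ = φ). Given f, g : Q × Q → K, equip Q × K with the operations (a,α)⊕(b,β) = (a·b, (α+β)+f(a,b)) and (a,α)⊛(b,β) = (a·b, (α∗β)∗g(a,b)). Then the bijection T : Q × K → Q × K, T(a,α) = (a, τ(α)), is a magma isomorphism from (Q×K, ⊕) onto (Q×K, ⊛) if and only if φ(τ(f(a,b))) = g(a,b) for all a, b ∈ Q. -/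
/-- Theorem 1(ii): for involutory automorphisms `φ = φ₁ = φ₂` and `τ` of the quasigroup `(K,+)`,
the `f`-extension `(Q × K, ⊕)` of `(K,+)` by `(Q,·)` and the `g`-extension `(Q × K, ⊛)` of the
principal isotope `(K,∗)` (where `α∗β = φ(α)+φ(β)`) by `(Q,·)` are isomorphic via
`T(a,α) = (a, τ(α))` if and only if `φ(τ(f(a,b))) = g(a,b)` for all `a, b ∈ Q`. -/
theorem stmt_1 {Q K : Type*} (mulQ : Q → Q → Q)
    (hQl : ∀ a : Q, Function.Bijective (fun x => mulQ a x))
    (hQr : ∀ a : Q, Function.Bijective (fun x => mulQ x a))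
    (add : K → K → K)
    (hKl : ∀ α : K, Function.Bijective (fun ξ => add α ξ))
    (hKr : ∀ α : K, Function.Bijective (fun ξ => add ξ α))
    (hK : Nonempty K)
    (φ : K → K) (hφbij : Function.Bijective φ)
    (hφinv : ∀ α, φ (φ α) = α)
    (hφadd : ∀ α β, φ (add α β) = add (φ α) (φ β))
    (τ : K → K) (hτbij : Function.Bijective τ)
    (hτinv : ∀ α, τ (τ α) = α)
    (hτadd : ∀ α β, τ (add α β) = add (τ α) (τ β))
    (star : K → K → K) (hstar : ∀ α β, star α β = add (φ α) (φ β))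
    (f g : Q × Q → K)
    (op1 : Q × K → Q × K → Q × K)
    (hop1 : ∀ a b α β, op1 (a, α) (b, β) = (mulQ a b, add (add α β) (f (a, b))))
    (op2 : Q × K → Q × K → Q × K)
    (hop2 : ∀ a b α β, op2 (a, α) (b, β) = (mulQ a b, star (star α β) (g (a, b))))
    (T : Q × K → Q × K) (hT : ∀ a α, T (a, α) = (a, τ α)) :
    (∀ z w : Q × K, T (op1 z w) = op2 (T z) (T w)) ↔ ∀ a b : Q, φ (τ (f (a, b))) = g (a, b) := by
  constructor
  · intro h a b
    obtain ⟨α⟩ := hK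
    have hab := h (a, α) (b, α)
    simp only [hop1, hop2, hT, hstar, hφadd, hτadd, hφinv, Prod.mk.injEq, true_and] at hab
    rw [(hKl _).injective hab, hφinv]
  · rintro h ⟨a, α⟩ ⟨b, β⟩
    simp only [hop1, hop2, hT, hstar, hφadd, hτadd, hφinv, ← h]
end

section
/- Let (Q,·) be a quasigroup and f : Q × Q → ZMod 3. On Q × ZMod 3 define the operation ⊕ by (a,α)⊕(b,β) = (a·b, (α+β)+f(a,b)) (the f-extension of the cyclic group Z₃ by Q), and define ◻ by (a,α)◻(b,β) = (a·b, (α◇β)◇f(a,b)), where α◇β = -α-β-1 (the f-extension of the commutative quasigroup Q₃ of order 3 having no idempotent element, with the same factor system f). Then the map T : Q × ZMod 3 → Q × ZMod 3, T(a,α) = (a, -α), is a magma isomorphism from (Q × ZMod 3, ◻) onto (Q × ZMod 3, ⊕). -/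
/-- The `f`-extension of the commutative quasigroup `Q₃` of order 3 with no idempotent
element (i.e. `ZMod 3` with `α◇β = -α-β-1`) by a quasigroup `Q` is isomorphic, via
`T(a,α) = (a,-α)`, to the `f`-extension of the cyclic group `Z₃` by `Q` with the same
factor system `f`. -/
theorem stmt_3 {Q : Type*} (mulQ : Q → Q → Q)
    (hQl : ∀ a : Q, Function.Bijective (fun x => mulQ a x))
    (hQr : ∀ a : Q, Function.Bijective (fun x => mulQ x a))
    (f : Q × Q → ZMod 3)
    (diam : ZMod 3 → ZMod 3 → ZMod 3) (hdiam : ∀ α β, diam α β = -α - β - 1)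
    (op1 : Q × ZMod 3 → Q × ZMod 3 → Q × ZMod 3)
    (hop1 : ∀ a b α β, op1 (a, α) (b, β) = (mulQ a b, (α + β) + f (a, b)))
    (op2 : Q × ZMod 3 → Q × ZMod 3 → Q × ZMod 3)
    (hop2 : ∀ a b α β, op2 (a, α) (b, β) = (mulQ a b, diam (diam α β) (f (a, b))))
    (T : Q × ZMod 3 → Q × ZMod 3) (hT : ∀ a α, T (a, α) = (a, -α)) :
    Function.Bijective T ∧ ∀ z w : Q × ZMod 3, T (op2 z w) = op1 (T z) (T w) := by
  refine ⟨Function.Involutive.bijective fun ⟨a, α⟩ => by rw [hT, hT, neg_neg], ?_⟩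
  rintro ⟨a, α⟩ ⟨b, β⟩
  rw [hop2, hT, hT, hT, hop1, hdiam, hdiam]
  congr 1
  ring
end

section
/- Every oriented Steiner quasigroup is flexible: for all z, w ∈ Q × ℤˣ one has z ∘ (w ∘ z) = (z ∘ w) ∘ z. -/
/-- Every oriented Steiner quasigroup (the extension of `Z₂ = ℤˣ` by a Steiner
quasigroup `Q` via an orientation function `f`) is flexible:
`z ∘ (w ∘ z) = (z ∘ w) ∘ z`. -/
theorem stmt_5 {Q : Type*} (mul : Q → Q → Q)
    (hidem : ∀ x, mul x x = x)
    (hcomm : ∀ x y, mul x y = mul y x)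
    (hkey : ∀ x y, mul x (mul x y) = y)
    (ε : ℤˣ) (f : Q → Q → ℤˣ)
    (hf1 : ∀ x, f x x = ε)
    (hf2 : ∀ x y, x ≠ y → f x y * f y x = -1)
    (hf3 : ∀ x y, x ≠ y → f x y = f y (mul x y))
    (op : Q × ℤˣ → Q × ℤˣ → Q × ℤˣ)
    (hop : ∀ (a b : Q) (α β : ℤˣ), op (a, α) (b, β) = (mul a b, f a b * α * β)) :
    ∀ z w : Q × ℤˣ, op z (op w z) = op (op z w) z := by
  rintro ⟨a, α⟩ ⟨b, β⟩
  have hba : mul b (mul a b) = a := by rw [hcomm a b, hkey]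
  have hsign : f a (mul b a) * f b a = f (mul a b) a * f a b := by
    by_cases hab : a = b
    · subst hab
      simp [hidem, hf1]
    · have hbc : b ≠ mul a b := fun h => hab (by rw [← h, hidem] at hba; exact hba.symm)
      have hrot : f a b = f (mul a b) a := by
        rw [hf3 a b hab, hf3 b (mul a b) hbc, hba]
      rw [← hf3 b a (Ne.symm hab), ← hrot, Int.units_mul_self, Int.units_mul_self]
  simp only [hop, Prod.mk.injEq]
  refine ⟨by rw [hcomm b a, hcomm (mul a b) a], ?_⟩
  calc f a (mul b a) * α * (f b a * β * α)
      = (f a (mul b a) * f b a) * (α * β * α) := by ac_rfl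
    _ = (f (mul a b) a * f a b) * (α * β * α) := by rw [hsign]
    _ = f (mul a b) a * (f a b * α * β) * α := by ac_rfl
end

section
/- Every oriented Steiner quasigroup has the cross inverse property with each element its own cross inverse: for all z, w ∈ Q × ℤˣ one has (z ∘ w) ∘ z = w. -/
/-- Every oriented Steiner quasigroup has the cross inverse property, with each
element its own cross inverse: `(z ∘ w) ∘ z = w`. -/
theorem stmt_6 {Q : Type*} (mul : Q → Q → Q)
    (hidem : ∀ x, mul x x = x)
    (hcomm : ∀ x y, mul x y = mul y x)
    (hkey : ∀ x y, mul x (mul x y) = y)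
    (ε : ℤˣ) (f : Q → Q → ℤˣ)
    (hf1 : ∀ x, f x x = ε)
    (hf2 : ∀ x y, x ≠ y → f x y * f y x = -1)
    (hf3 : ∀ x y, x ≠ y → f x y = f y (mul x y))
    (op : Q × ℤˣ → Q × ℤˣ → Q × ℤˣ)
    (hop : ∀ (a b : Q) (α β : ℤˣ), op (a, α) (b, β) = (mul a b, f a b * α * β)) :
    ∀ z w : Q × ℤˣ, op (op z w) z = w := by
  have hba : ∀ a b, mul b (mul a b) = a := fun a b => by rw [hcomm a b, hkey]
  have hcyc : ∀ a b, f (mul a b) a = f a b := by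
    intro a b
    by_cases h : a = b
    · rw [h, hidem]
    · have hb : b ≠ mul a b := fun e => h <| by
        have h' := hba a b
        rw [← e, hidem] at h'
        exact h'.symm
      rw [hf3 a b h, hf3 b _ hb, hba]
  rintro ⟨a, α⟩ ⟨b, β⟩
  rw [hop, hop, hcyc, hcomm (mul a b) a, hkey]
  congr 1
  calc f a b * (f a b * α * β) * α = (f a b * f a b) * (α * α) * β := by
        ac_rfl
    _ = β := by rw [Int.units_mul_self, Int.units_mul_self, one_mul, one_mul]
end

section
/- Every oriented Steiner quasigroup is semi-symmetric: for all z, w ∈ Q × ℤˣ one has z ∘ (w ∘ z) = w. -/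
/-- Every oriented Steiner quasigroup is semi-symmetric: `z ∘ (w ∘ z) = w`. -/
theorem stmt_7 {Q : Type*} (mul : Q → Q → Q)
    (hidem : ∀ x, mul x x = x)
    (hcomm : ∀ x y, mul x y = mul y x)
    (hkey : ∀ x y, mul x (mul x y) = y)
    (ε : ℤˣ) (f : Q → Q → ℤˣ)
    (hf1 : ∀ x, f x x = ε)
    (hf2 : ∀ x y, x ≠ y → f x y * f y x = -1)
    (hf3 : ∀ x y, x ≠ y → f x y = f y (mul x y))
    (op : Q × ℤˣ → Q × ℤˣ → Q × ℤˣ)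
    (hop : ∀ (a b : Q) (α β : ℤˣ), op (a, α) (b, β) = (mul a b, f a b * α * β)) :
    ∀ z w : Q × ℤˣ, op z (op w z) = w := by
  rintro ⟨a, α⟩ ⟨b, β⟩
  have hf : f a (mul b a) = f b a := by
    by_cases h : b = a
    · rw [h, hidem]
    · exact (hf3 b a h).symm
  have hmul : mul a (mul b a) = b := by rw [hcomm b a, hkey]
  rw [hop, hop, hmul, hf]
  congr 1
  calc f b a * α * (f b a * β * α) = f b a * f b a * (α * α) * β := by
        simp only [mul_comm, mul_left_comm]
    _ = β := by simp only [Int.units_mul_self, one_mul]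
end

section
/- Every canonical oriented Steiner quasigroup satisfies the inverse property: defining ι : Q × ZMod 3 → Q × ZMod 3 by ι(a,α) = (a,-α), one has ι(z) ∘ (z ∘ w) = w and (w ∘ z) ∘ ι(z) = w for all z, w ∈ Q × ZMod 3. -/
/-- Every canonical oriented Steiner quasigroup (the extension of `Z₃` by a Steiner
quasigroup `Q` via an orientation function `f`) satisfies the inverse property, with
`ι(a,α) = (a,-α)`: both `ι(z) ∘ (z ∘ w) = w` and `(w ∘ z) ∘ ι(z) = w`. -/
theorem stmt_8 {Q : Type*} (mul : Q → Q → Q)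
    (hidem : ∀ x, mul x x = x)
    (hcomm : ∀ x y, mul x y = mul y x)
    (hkey : ∀ x y, mul x (mul x y) = y)
    (f : Q → Q → ZMod 3)
    (hf1 : ∀ x, f x x = 0)
    (hf2 : ∀ x y, x ≠ y → f x y ≠ 0)
    (hf3 : ∀ x y, x ≠ y → f y x = -f x y)
    (hf4 : ∀ x y, x ≠ y → f x y = f y (mul x y))
    (op : Q × ZMod 3 → Q × ZMod 3 → Q × ZMod 3)
    (hop : ∀ (a b : Q) (α β : ZMod 3), op (a, α) (b, β) = (mul a b, α + β + f a b))
    (ι : Q × ZMod 3 → Q × ZMod 3) (hι : ∀ a α, ι (a, α) = (a, -α)) :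
    ∀ z w : Q × ZMod 3, op (ι z) (op z w) = w ∧ op (op w z) (ι z) = w := by
  have hleft : ∀ a b, f a b + f a (mul a b) = 0 := by
    intro a b
    by_cases h : a = b
    · subst h
      simp [hidem, hf1]
    · rw [hcomm a b, ← hf4 b a (Ne.symm h), hf3 a b h, add_neg_cancel]
  have hright : ∀ a b, f b a + f (mul b a) a = 0 := by
    intro a b
    by_cases h : a = b
    · subst h
      simp [hidem, hf1]
    · have hne : a ≠ mul b a := by
        intro e
        apply h
        have hk := hkey a b
        rwa [hcomm a b, ← e, hidem] at hk
      rw [hf3 a (mul b a) hne, ← hf4 b a (Ne.symm h), add_neg_cancel]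
  rintro ⟨a, α⟩ ⟨b, β⟩
  simp only [hι, hop, Prod.mk.injEq]
  refine ⟨⟨hkey a b, ?_⟩, ?_, ?_⟩
  · linear_combination hleft a b
  · rw [hcomm (mul b a) a, hcomm b a, hkey]
  · linear_combination hright a b
end

section
/- If Q has at least two elements, then the oriented Steiner quasigroup does not have the left inverse property: there exists no function ι : Q × ℤˣ → Q × ℤˣ such that ι(z) ∘ (z ∘ w) = w for all z, w ∈ Q × ℤˣ. -/
/-- If `Q` has at least two elements, the oriented Steiner quasigroup does not have
the left inverse property: no map `ι` satisfies `ι(z) ∘ (z ∘ w) = w` for all `z, w`. -/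
theorem stmt_9 {Q : Type*} (mul : Q → Q → Q)
    (hidem : ∀ x, mul x x = x)
    (hcomm : ∀ x y, mul x y = mul y x)
    (hkey : ∀ x y, mul x (mul x y) = y)
    (ε : ℤˣ) (f : Q → Q → ℤˣ)
    (hf1 : ∀ x, f x x = ε)
    (hf2 : ∀ x y, x ≠ y → f x y * f y x = -1)
    (hf3 : ∀ x y, x ≠ y → f x y = f y (mul x y))
    (op : Q × ℤˣ → Q × ℤˣ → Q × ℤˣ)
    (hop : ∀ (a b : Q) (α β : ℤˣ), op (a, α) (b, β) = (mul a b, f a b * α * β))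
    (hQ : ∃ a b : Q, a ≠ b) :
    ¬ ∃ ι : Q × ℤˣ → Q × ℤˣ, ∀ z w : Q × ℤˣ, op (ι z) (op z w) = w := by
  rintro ⟨ι, hι⟩
  obtain ⟨a, b, hab⟩ := hQ
  rcases h : ι (a, 1) with ⟨c, γ⟩
  have hinv : ∀ w : Q, mul c (mul a w) = w ∧ f c (mul a w) * γ * f a w = 1 := by
    intro w
    have hw := hι (a, 1) (w, 1)
    rw [h, hop, hop, Prod.mk.injEq] at hw
    exact ⟨hw.1, by simpa using hw.2⟩
  have hca : c = a := by
    have hc := (hinv a).1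
    rw [hidem, hcomm] at hc
    have hk := hkey a c
    rw [hc, hidem] at hk
    exact hk.symm
  subst hca
  have hγ : γ = 1 := by
    have h1 := (hinv c).2
    rw [hidem, hf1, mul_right_comm, Int.units_mul_self, one_mul] at h1
    exact h1
  have hb_ne : b ≠ mul c b := by
    intro hb
    have hk := hkey b c
    rw [hcomm b c, ← hb, hidem] at hk
    exact hab hk.symm
  have hc_ne : c ≠ mul c b := by
    intro hc
    have hk := hkey c b
    rw [← hc, hidem] at hk
    exact hab hk
  have hcyc : f c b = f (mul c b) c := by
    rw [hf3 c b hab, hf3 b (mul c b) hb_ne, hcomm c b, hkey]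
  have hone := (hinv b).2
  rw [hγ, mul_one, hcyc, hf2 c (mul c b) hc_ne] at hone
  exact absurd hone (by decide)
end

section
/- If Q has at least two elements, then the canonical oriented Steiner quasigroup is not flexible: there exist z, w ∈ Q × ZMod 3 with z ∘ (w ∘ z) ≠ (z ∘ w) ∘ z. -/
/-- If `Q` has at least two elements, the canonical oriented Steiner quasigroup is
not flexible: `z ∘ (w ∘ z) ≠ (z ∘ w) ∘ z` for some `z, w`. -/
theorem stmt_10 {Q : Type*} (mul : Q → Q → Q)
    (hidem : ∀ x, mul x x = x)
    (hcomm : ∀ x y, mul x y = mul y x)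
    (hkey : ∀ x y, mul x (mul x y) = y)
    (f : Q → Q → ZMod 3)
    (hf1 : ∀ x, f x x = 0)
    (hf2 : ∀ x y, x ≠ y → f x y ≠ 0)
    (hf3 : ∀ x y, x ≠ y → f y x = -f x y)
    (hf4 : ∀ x y, x ≠ y → f x y = f y (mul x y))
    (op : Q × ZMod 3 → Q × ZMod 3 → Q × ZMod 3)
    (hop : ∀ (a b : Q) (α β : ZMod 3), op (a, α) (b, β) = (mul a b, α + β + f a b))
    (hQ : ∃ a b : Q, a ≠ b) :
    ∃ z w : Q × ZMod 3, op z (op w z) ≠ op (op z w) z := by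
  obtain ⟨a, b, hab⟩ := hQ
  have hba : mul b (mul a b) = a := by rw [hcomm a b, hkey]
  have hb : b ≠ mul a b := fun h => hab (by rw [← h, hidem] at hba; exact hba.symm)
  have ha : mul a b ≠ a := fun h => hab (by simpa [h, hidem] using hkey a b)
  have h1 : f (mul a b) a = f a b := by
    rw [hf4 a b hab, hf4 b _ hb, hba]
  refine ⟨(a, 0), (b, 0), fun h => hf2 a b hab ?_⟩
  rw [hop, hop, hop, hop, hcomm b a, hf3 a b hab, hf3 _ a ha, h1] at h
  have h2 := congrArg Prod.snd h
  have h3 : (3 : ZMod 3) = 0 := rfl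
  dsimp only at h2
  linear_combination -h2 - h3 * f a b
end

section
/- If Q has at least two elements, then the canonical oriented Steiner quasigroup does not have the left cross inverse property: there exists no function δ : Q × ZMod 3 → Q × ZMod 3 such that (z ∘ w) ∘ δ(z) = w for all z, w ∈ Q × ZMod 3. -/
/-- If `Q` has at least two elements, the canonical oriented Steiner quasigroup does
not have the left cross inverse property: no map `δ` satisfies `(z ∘ w) ∘ δ(z) = w`
for all `z, w`. -/
theorem stmt_12 {Q : Type*} (mul : Q → Q → Q)
    (hidem : ∀ x, mul x x = x)
    (hcomm : ∀ x y, mul x y = mul y x)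
    (hkey : ∀ x y, mul x (mul x y) = y)
    (f : Q → Q → ZMod 3)
    (hf1 : ∀ x, f x x = 0)
    (hf2 : ∀ x y, x ≠ y → f x y ≠ 0)
    (hf3 : ∀ x y, x ≠ y → f y x = -f x y)
    (hf4 : ∀ x y, x ≠ y → f x y = f y (mul x y))
    (op : Q × ZMod 3 → Q × ZMod 3 → Q × ZMod 3)
    (hop : ∀ (a b : Q) (α β : ZMod 3), op (a, α) (b, β) = (mul a b, α + β + f a b))
    (hQ : ∃ a b : Q, a ≠ b) :
    ¬ ∃ δ : Q × ZMod 3 → Q × ZMod 3, ∀ z w : Q × ZMod 3, op (op z w) (δ z) = w := by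
  rintro ⟨δ, hδ⟩
  obtain ⟨a, b, hab⟩ := hQ
  obtain ⟨⟨d, γ⟩, hd⟩ : ∃ p, δ (a, 0) = p := ⟨_, rfl⟩
  have haa := hδ (a, 0) (a, 0)
  have hzw := hδ (a, 0) (b, 0)
  rw [hd, hop, hop, Prod.mk.injEq] at haa hzw
  rw [hidem, hf1] at haa
  have hda : d = a := by rw [← hkey a d, haa.1, hidem]
  subst hda
  have hγ : γ = 0 := by simpa [hf1] using haa.2
  have hba : mul b (mul d b) = d := by rw [hcomm d b, hkey]
  have hne : b ≠ mul d b := fun h => hab (by rw [← hba, ← h, hidem])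
  have hcyc : f d b = f (mul d b) d := by
    rw [hf4 d b hab, hf4 b (mul d b) hne, hba]
  have hsum : f d b + f d b = 0 := by
    simpa [hγ, ← hcyc] using hzw.2
  have hdouble : ∀ x : ZMod 3, x + x = 0 → x = 0 := by decide
  exact hf2 d b hab (hdouble _ hsum)
end

section
/- The set of left-regular permutations of an oriented Steiner quasigroup, i.e. the set of bijections λ : Q × ℤˣ → Q × ℤˣ satisfying λ(z ∘ w) = λ(z) ∘ w for all z, w, is exactly {id, σ₀}, where σ₀(a,α) = (a,-α); in particular, this group of permutations is isomorphic to the group Z₂ whenever Q is nonempty. -/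
/-- The left-regular permutations of an oriented Steiner quasigroup are exactly
`{id, σ₀}` where `σ₀(a,α) = (a,-α)`; in particular this group is isomorphic to `Z₂`
whenever `Q` is nonempty. -/
theorem stmt_15 {Q : Type*} (mul : Q → Q → Q)
    (hidem : ∀ x, mul x x = x)
    (hcomm : ∀ x y, mul x y = mul y x)
    (hkey : ∀ x y, mul x (mul x y) = y)
    (ε : ℤˣ) (f : Q → Q → ℤˣ)
    (hf1 : ∀ x, f x x = ε)
    (hf2 : ∀ x y, x ≠ y → f x y * f y x = -1)
    (hf3 : ∀ x y, x ≠ y → f x y = f y (mul x y))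
    (op : Q × ℤˣ → Q × ℤˣ → Q × ℤˣ)
    (hop : ∀ (a b : Q) (α β : ℤˣ), op (a, α) (b, β) = (mul a b, f a b * α * β)) :
    ({σ : Q × ℤˣ → Q × ℤˣ | Function.Bijective σ ∧ ∀ z w, σ (op z w) = op (σ z) w}
        = {id, fun z => (z.1, -z.2)}) ∧
    (Nonempty Q →
      Nonempty ({σ : Q × ℤˣ → Q × ℤˣ //
        Function.Bijective σ ∧ ∀ z w, σ (op z w) = op (σ z) w} ≃ ZMod 2)) := by
  have set_eq : {σ : Q × ℤˣ → Q × ℤˣ | Function.Bijective σ ∧ ∀ z w, σ (op z w) = op (σ z) w}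
      = {id, fun z => (z.1, -z.2)} := by
    ext σ
    simp only [Set.mem_ofPred_eq, Set.mem_insert_iff, Set.mem_singleton_iff]
    constructor
    · rintro ⟨-, hσ⟩
      have fst_eq : ∀ a α, (σ (a, α)).1 = a := by
        intro a α
        have h := congrArg Prod.fst (hσ (a, α) (a, f a a))
        rw [hop, hidem, mul_right_comm, Int.units_mul_self, one_mul] at h
        generalize σ (a, α) = z at h ⊢
        obtain ⟨p, s⟩ := z
        rw [hop] at h
        have hp : p = mul p a := h
        calc p = mul p p := (hidem p).symm
          _ = mul p (mul p a) := congrArg (mul p) hp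
          _ = a := hkey p a
      rcases isEmpty_or_nonempty Q with hQ | ⟨⟨a⟩⟩
      · exact Or.inl (funext fun z => isEmptyElim z.1)
      have scalar : ∀ z, σ z = (z.1, (σ (a, 1)).2 * z.2) := by
        rintro ⟨b, γ⟩
        have h := hσ (a, 1) (mul a b, f a (mul a b) * γ)
        have ha : σ (a, 1) = (a, (σ (a, 1)).2) := Prod.ext (fst_eq a 1) rfl
        rw [ha, hop, hop, hkey, mul_one, ← mul_assoc, Int.units_mul_self, one_mul,
          mul_mul_mul_comm, Int.units_mul_self, one_mul] at h
        exact h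
      rcases Int.units_eq_one_or (σ (a, 1)).2 with hs | hs
      · left
        funext z
        rw [scalar, hs, one_mul, id]
      · right
        funext z
        rw [scalar, hs, neg_one_mul]
    · rintro (rfl | rfl)
      · exact ⟨Function.bijective_id, fun _ _ => rfl⟩
      · refine ⟨Function.Involutive.bijective fun z => by simp, ?_⟩
        rintro ⟨a, α⟩ ⟨b, β⟩
        simp [hop]
  refine ⟨set_eq, ?_⟩
  rintro ⟨a⟩
  have hne : (id : Q × ℤˣ → Q × ℤˣ) ≠ fun z => (z.1, -z.2) := fun h =>
    absurd (congrArg Prod.snd (congrFun h (a, 1))) (show (1 : ℤˣ) ≠ -1 by decide)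
  refine Nonempty.map (Equiv.setCongr set_eq).trans (Finite.card_eq.mp ?_)
  rw [Nat.card_coe_set_eq, Set.ncard_pair hne, Nat.card_zmod]
end

section
/- The set of right-regular permutations of a canonical oriented Steiner quasigroup, i.e. the set of bijections σ : Q × ZMod 3 → Q × ZMod 3 satisfying σ(z ∘ w) = z ∘ σ(w) for all z, w, is exactly {σ_c : c ∈ ZMod 3}, where σ_c(a,α) = (a, α + c); in particular, this group of permutations is isomorphic to the group Z₃ whenever Q is nonempty. The same holds for the set of left-regular permutations, i.e. bijections λ with λ(z ∘ w) = λ(z) ∘ w for all z, w. -/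
/-- A map `σ` of `Q × ZMod 3` commutes with all left translations of the extension of `(Q, mul)`
by `f` if and only if it is a translation of the second coordinate. -/
theorem rightRegular_eq_fiberTranslations {Q : Type*} (mul : Q → Q → Q)
    (hidem : ∀ x, mul x x = x) (hcomm : ∀ x y, mul x y = mul y x)
    (hkey : ∀ x y, mul x (mul x y) = y)
    (f : Q → Q → ZMod 3) (hf1 : ∀ x, f x x = 0) (hf2 : ∀ x y, x ≠ y → f x y ≠ 0)
    (op : Q × ZMod 3 → Q × ZMod 3 → Q × ZMod 3)
    (hop : ∀ (a b : Q) (α β : ZMod 3), op (a, α) (b, β) = (mul a b, α + β + f a b)) :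
    {σ : Q × ZMod 3 → Q × ZMod 3 | Function.Bijective σ ∧ ∀ z w, σ (op z w) = op z (σ w)}
      = {σ | ∃ c : ZMod 3, σ = fun z => (z.1, z.2 + c)} := by
  ext σ
  constructor
  · rintro ⟨-, hσ⟩
    have hfst (w : Q × ZMod 3) : (σ w).1 = w.1 := by
      obtain ⟨b, β⟩ := w
      have h := hσ (b, 0) (b, β)
      rw [← Prod.mk.eta (p := σ (b, β)), hop, hop, hidem, hf1, zero_add, add_zero, zero_add] at h
      have h2 : f b (σ (b, β)).1 = 0 := by simpa using congrArg Prod.snd h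
      by_contra hne
      exact hf2 _ _ (Ne.symm hne) h2
    have htrans (a b : Q) (α β : ZMod 3) :
        (σ (mul a b, α + β + f a b)).2 = α + (σ (b, β)).2 + f a b := by
      have h := hσ (a, α) (b, β)
      rw [← Prod.mk.eta (p := σ (b, β)), hfst, hop, hop] at h
      exact congrArg Prod.snd h
    rcases isEmpty_or_nonempty Q with hQ | ⟨⟨q⟩⟩
    · exact ⟨0, Subsingleton.elim _ _⟩
    · refine ⟨(σ (q, 0)).2, funext fun ⟨b, β⟩ => Prod.ext (hfst _) ?_⟩
      have h := htrans (mul q b) q (β - f (mul q b) q) 0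
      rw [hcomm (mul q b) q, hkey, add_zero, sub_add_cancel] at h
      rw [h]
      ring
  · rintro ⟨c, rfl⟩
    refine ⟨⟨?_, ?_⟩, ?_⟩
    · rintro ⟨a, α⟩ ⟨b, β⟩ h
      simpa using h
    · rintro ⟨a, α⟩
      exact ⟨(a, α - c), by simp⟩
    · rintro ⟨a, α⟩ ⟨b, β⟩
      simp only [hop, Prod.mk.injEq, true_and]
      ring

/-- Translations of the second coordinate of `Q × ZMod 3` are parametrized by `ZMod 3`. -/
theorem nonempty_fiberTranslations_equiv {Q : Type*} [Nonempty Q] :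
    Nonempty ({σ : Q × ZMod 3 → Q × ZMod 3 | ∃ c : ZMod 3, σ = fun z => (z.1, z.2 + c)}
      ≃ ZMod 3) := by
  obtain ⟨q⟩ := ‹Nonempty Q›
  let g : ZMod 3 → Q × ZMod 3 → Q × ZMod 3 := fun c z => (z.1, z.2 + c)
  have hg : Function.Injective g := fun c d h => by
    simpa [g] using congrFun h (q, 0)
  exact ⟨(Equiv.setCongr (Set.ext fun σ => exists_congr fun c => eq_comm)).trans
    (Equiv.ofInjective g hg).symm⟩


/-- The right-regular permutations of a canonical oriented Steiner quasigroup are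
exactly the maps `σ_c(a,α) = (a, α + c)` for `c ∈ ZMod 3`, and likewise for the
left-regular permutations; in particular both groups are isomorphic to `Z₃`
whenever `Q` is nonempty. -/
theorem stmt_16 {Q : Type*} (mul : Q → Q → Q)
    (hidem : ∀ x, mul x x = x)
    (hcomm : ∀ x y, mul x y = mul y x)
    (hkey : ∀ x y, mul x (mul x y) = y)
    (f : Q → Q → ZMod 3)
    (hf1 : ∀ x, f x x = 0)
    (hf2 : ∀ x y, x ≠ y → f x y ≠ 0)
    (hf3 : ∀ x y, x ≠ y → f y x = -f x y)
    (hf4 : ∀ x y, x ≠ y → f x y = f y (mul x y))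
    (op : Q × ZMod 3 → Q × ZMod 3 → Q × ZMod 3)
    (hop : ∀ (a b : Q) (α β : ZMod 3), op (a, α) (b, β) = (mul a b, α + β + f a b)) :
    ({σ : Q × ZMod 3 → Q × ZMod 3 | Function.Bijective σ ∧ ∀ z w, σ (op z w) = op z (σ w)}
        = {σ | ∃ c : ZMod 3, σ = fun z => (z.1, z.2 + c)}) ∧
    ({σ : Q × ZMod 3 → Q × ZMod 3 | Function.Bijective σ ∧ ∀ z w, σ (op z w) = op (σ z) w}
        = {σ | ∃ c : ZMod 3, σ = fun z => (z.1, z.2 + c)}) ∧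
    (Nonempty Q →
      Nonempty ({σ : Q × ZMod 3 → Q × ZMod 3 //
        Function.Bijective σ ∧ ∀ z w, σ (op z w) = op z (σ w)} ≃ ZMod 3)) ∧
    (Nonempty Q →
      Nonempty ({σ : Q × ZMod 3 → Q × ZMod 3 //
        Function.Bijective σ ∧ ∀ z w, σ (op z w) = op (σ z) w} ≃ ZMod 3)) := by
  have hright := rightRegular_eq_fiberTranslations mul hidem hcomm hkey f hf1 hf2 op hop
  have hleft : {σ : Q × ZMod 3 → Q × ZMod 3 |
      Function.Bijective σ ∧ ∀ z w, σ (op z w) = op (σ z) w}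
        = {σ | ∃ c : ZMod 3, σ = fun z => (z.1, z.2 + c)} :=
    (Set.ext fun σ => and_congr_right fun _ => forall_comm).trans <| rightRegular_eq_fiberTranslations mul hidem hcomm hkey (fun x y => f y x) hf1
    (fun x y h => hf2 y x h.symm) (fun z w => op w z)
    (fun a b α β => by rw [hop, hcomm b a, add_comm β α])
  refine ⟨hright, hleft, fun _ => ?_, fun _ => ?_⟩
  · exact nonempty_fiberTranslations_equiv.map (Equiv.setCongr hright).trans
  · exact nonempty_fiberTranslations_equiv.map (Equiv.setCongr hleft).trans
end
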